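/- arXiv:1811.05618 — 5 statements merged into one kernel-verified Lean document; each statement's English description precedes it below -/
import Mathlib

section
/- For every finite set X, removing all benign elements does not change the test value: Test(AV(X)) = Test(X). More generally, for any set S with AV(X) ⊆ S ⊆ X one has Test(S) = Test(AV(X)). -/
variable {α : Type*} [DecidableEq α]

/-- `x` is a benign element of `X`: adding it to any subset of `X` does not
change the test value. -/
def Benign (Test : Finset α → ℝ) (x : α) (X : Finset α) : Prop :=
  ∀ Y ⊆ X, Test Y = Test (Y ∪ {x})

open Classical in
/-- The set of all variable (non-benign) elements of `X`. -/
noncomputable def AV (Test : Finset α → ℝ) (X : Finset α) : Finset α :=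
  X.filter (fun x => ¬ Benign Test x X)


/-- Adjoining benign elements of `X` to a subset of `X` does not change the test value. -/
theorem test_union_eq_of_benign (Test : Finset α → ℝ) {X Y T : Finset α} (hY : Y ⊆ X)
    (hT : T ⊆ X) (hB : ∀ x ∈ T, Benign Test x X) : Test (Y ∪ T) = Test Y := by
  induction T using Finset.induction_on with
  | empty => simp
  | insert a T _ ih =>
    have hTX : T ⊆ X := (Finset.subset_insert a T).trans hT
    have h := hB a (Finset.mem_insert_self a T) (Y ∪ T) (Finset.union_subset hY hTX)
    rw [Finset.union_insert, Finset.insert_eq, Finset.union_comm {a}, ← h]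
    exact ih hTX fun x hx => hB x (Finset.mem_insert_of_mem hx)

/-- Removing all benign elements does not change the test value, and more
generally any set squeezed between `AV X` and `X` has the same test value
as `AV X`. -/
theorem test_AV_eq (Test : Finset α → ℝ) (X : Finset α) :
    Test (AV Test X) = Test X ∧
      ∀ S : Finset α, AV Test X ⊆ S → S ⊆ X → Test S = Test (AV Test X) := by
  classical
  have hAV : AV Test X ⊆ X := by
    unfold AV
    exact Finset.filter_subset _ _
  have key : ∀ S : Finset α, AV Test X ⊆ S → S ⊆ X → Test S = Test (AV Test X) := by
    intro S hS hSX
    have h := test_union_eq_of_benign Test (T := S \ AV Test X) hAV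
      (Finset.sdiff_subset.trans hSX) fun x hx => by
        rw [Finset.mem_sdiff] at hx
        by_contra hB
        refine hx.2 ?_
        unfold AV
        exact Finset.mem_filter.mpr ⟨hSX hx.1, hB⟩
    rwa [Finset.union_sdiff_of_subset hS] at h
  exact ⟨(key X hAV subset_rfl).symm, key⟩
end

section
/- Uniqueness of the minimal set (main theorem): under Assumption 1, for every finite set U and every set Y, the relation MS′(Y,U) holds if and only if Y = AV(U). In particular MS′(AV(U),U) holds, and for every X ≠ AV(U), MS′(X,U) fails, so AV(U) is the unique minimal set of U. -/
variable {α : Type*} [DecidableEq α]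

/-- `Y` is a minimal set for `U`: `Y ⊆ U`, `Test Y = Test U`, and every
proper subset of `Y` fails this test. -/
def MS' (Test : Finset α → ℝ) (Y U : Finset α) : Prop :=
  Y ⊆ U ∧ Test Y = Test U ∧ ∀ Z ⊂ Y, Test Z ≠ Test U

theorem AV_subset (Test : Finset α → ℝ) (X : Finset α) : AV Test X ⊆ X := by
  classical exact Finset.filter_subset _ _

/-- Adding benign elements of `X` to a subset of `X` does not change the test value. -/
theorem Test_union_of_forall_benign (Test : Finset α → ℝ) {X Y S : Finset α}
    (hY : Y ⊆ X) (hS : S ⊆ X) (hb : ∀ x ∈ S, Benign Test x X) :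
    Test (Y ∪ S) = Test Y := by
  induction S using Finset.induction_on with
  | empty => simp
  | insert a s _ ih =>
    have hs : s ⊆ X := (Finset.subset_insert a s).trans hS
    have h := hb a (Finset.mem_insert_self a s) (Y ∪ s) (Finset.union_subset hY hs)
    rw [← ih hs fun x hx => hb x (Finset.mem_insert_of_mem hx), h, Finset.insert_eq,
      Finset.union_assoc, Finset.union_comm s]

theorem Test_AV (Test : Finset α → ℝ) (X : Finset α) : Test (AV Test X) = Test X := by
  have hb : ∀ x ∈ X \ AV Test X, Benign Test x X := by
    intro x hx
    by_contra h
    rw [Finset.mem_sdiff] at hx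
    exact hx.2 (by simp [AV, hx.1, h])
  rw [← Test_union_of_forall_benign Test (AV_subset Test X) Finset.sdiff_subset hb,
    Finset.union_sdiff_of_subset (AV_subset Test X)]

/-- Uniqueness of the minimal set: under Assumption 1, `MS' Y U` holds
iff `Y = AV U`; so `AV U` is the unique minimal set of `U`. -/
theorem MS'_iff_eq_AV (Test : Finset α → ℝ)
    (h1 : ∀ X Y : Finset α, Test X = Test Y ↔ AV Test X = AV Test Y)
    (U : Finset α) :
    ∀ Y : Finset α, MS' Test Y U ↔ Y = AV Test U := by
  have hsub : ∀ Z, Test Z = Test U → AV Test U ⊆ Z := fun Z hZ =>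
    (h1 Z U).1 hZ ▸ AV_subset Test Z
  intro Y
  constructor
  · rintro ⟨_, hT, hmin⟩
    by_contra hne
    exact hmin _ ((hsub Y hT).ssubset_of_ne (Ne.symm hne)) (Test_AV Test U)
  · rintro rfl
    exact ⟨AV_subset Test U, Test_AV Test U, fun Z hZ hT => hZ.not_subset (hsub Z hT)⟩
end

section
/- Every minimal set is a fixed point of AV: for any finite sets Y and U, if MS′(Y,U) holds then Y = AV(Y). (This holds without Assumption 1, using only that Test(AV(Y)) = Test(Y) and AV(Y) ⊆ Y.) -/
variable {α : Type*} [DecidableEq α]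

/-- Every minimal set is a fixed point of `AV` (no Assumption 1 needed). -/
theorem MS'_fixed_point (Test : Finset α → ℝ) (Y U : Finset α)
    (hMS : MS' Test Y U) :
    Y = AV Test Y := by
  obtain ⟨-, hYU, hmin⟩ := hMS
  classical
  refine (Finset.filter_eq_self.mpr ?_).symm
  intro x hx hB
  refine hmin (Y.erase x) (Finset.erase_ssubset hx) ?_
  rw [hB _ (Finset.erase_subset x Y), Finset.union_comm, ← Finset.insert_eq,
    Finset.insert_erase hx, hYU]
end

section
/- Dynamic verification of the Bisect algorithm implies no false negatives: under Assumption 1 and assuming Test(∅) = 0, if a finite set found ⊆ items satisfies (i) Test({x}) > 0 for every x ∈ found (the assertion in BisectOne) and (ii) Test(found) = Test(items) (the assertion in BisectAll), then found = AV(items), i.e., the algorithm has found exactly all variable elements of items. -/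
variable {α : Type*} [DecidableEq α]

/-- Dynamic verification implies no false negatives: if every found element
has positive singleton test value and the found set reproduces the test value
of the whole set, then the found set is exactly `AV items`. -/
theorem bisect_no_false_negatives (Test : Finset α → ℝ)
    (h1 : ∀ X Y : Finset α, Test X = Test Y ↔ AV Test X = AV Test Y)
    (h0 : Test ∅ = 0)
    (found items : Finset α) (hsub : found ⊆ items)
    (hpos : ∀ x ∈ found, 0 < Test {x})
    (heq : Test found = Test items) :
    found = AV Test items := by
  classical
  rw [← (h1 found items).1 heq, eq_comm, AV, Finset.filter_eq_self]
  intro x hx hb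
  have h : Test ∅ = Test {x} := by simpa using hb ∅ (Finset.empty_subset found)
  exact (hpos x hx).ne (h0.symm.trans h)
end

section
/- Correctness invariant of the BisectOne split step: under Assumption 1 and Assumption 2 for the set Δ₁ ∪ Δ₂, and assuming Test(∅) = 0 and Test takes only nonnegative values, if Test(Δ₁ ∪ Δ₂) > 0 and Test(Δ₁) = 0, then Test(Δ₂) > 0. Hence when the first half of the search space tests clean, the variability is guaranteed to be detectable in the second half. -/
variable {α : Type*} [DecidableEq α]

theorem mem_AV {Test : Finset α → ℝ} {X : Finset α} {x : α} :
    x ∈ AV Test X ↔ x ∈ X ∧ ¬ Benign Test x X := by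
  simp [AV]

theorem AV_empty (Test : Finset α → ℝ) : AV Test ∅ = ∅ := by
  simp [AV]

/-- Under distinct error magnitudes, every singleton of a set that tests clean tests clean. -/
theorem test_singleton_eq_zero {Test : Finset α → ℝ}
    (h1 : ∀ X Y : Finset α, Test X = Test Y ↔ AV Test X = AV Test Y)
    (h0 : Test ∅ = 0) {D : Finset α} (hD : Test D = 0) {x : α} (hx : x ∈ D) :
    Test {x} = 0 := by
  have hAV : AV Test D = ∅ := by
    rw [(h1 D ∅).mp (hD.trans h0.symm), AV_empty]
  have hbenign : Benign Test x D := by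
    by_contra hb
    have hmem : x ∈ AV Test D := mem_AV.mpr ⟨hx, hb⟩
    simp [hAV] at hmem
  simpa [h0] using (hbenign ∅ (Finset.empty_subset D)).symm

/-- Correctness invariant of the BisectOne split step: if the union is
variable but the first half tests clean, the second half must test positive. -/
theorem bisect_split_invariant (Test : Finset α → ℝ)
    (h1 : ∀ X Y : Finset α, Test X = Test Y ↔ AV Test X = AV Test Y)
    (D1 D2 : Finset α)
    (h2 : ∀ x ∈ AV Test (D1 ∪ D2), 0 < Test {x})
    (h0 : Test ∅ = 0)
    (hnonneg : ∀ S : Finset α, 0 ≤ Test S)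
    (hpos : 0 < Test (D1 ∪ D2))
    (hclean : Test D1 = 0) :
    0 < Test D2 := by
  have hD2 : Test D2 ≠ 0 := fun hD2 => by
    have hAV : AV Test (D1 ∪ D2) = ∅ := by
      rw [Finset.eq_empty_iff_forall_notMem]
      intro x hx
      refine (h2 x hx).ne' ?_
      have hmem : x ∈ D1 ∪ D2 := (mem_AV.mp hx).1
      rcases Finset.mem_union.mp hmem with hx | hx
      · exact test_singleton_eq_zero h1 h0 hclean hx
      · exact test_singleton_eq_zero h1 h0 hD2 hx
    have hunion : Test (D1 ∪ D2) = Test ∅ := (h1 _ _).mpr (by rw [hAV, AV_empty])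
    exact hpos.ne' (hunion.trans h0)
  exact (hnonneg D2).lt_of_ne' hD2
end
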